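/- With the same setup, if Q satisfies I(Q;Y|X)=I(Q;X|Y)=0, then I(X;Y|Q) = H(Q'|Q) + I(X;Y|Q') ≥ I(X;Y|Q'), where Q' is the connected-component random variable. -/

import Mathlib

open Finset

open Classical in
/-- Probability that random variable `X` (on finite weighted space `p`) equals `a`. -/
noncomputable def prob {Ω α : Type*} [Fintype Ω] (p : Ω → ℝ) (X : Ω → α) (a : α) : ℝ :=
  ∑ ω, if X ω = a then p ω else 0

/-- Shannon entropy of a random variable. -/
noncomputable def ent {Ω α : Type*} [Fintype Ω] [Fintype α] (p : Ω → ℝ) (X : Ω → α) : ℝ :=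
  ∑ a, Real.negMulLog (prob p X a)

/-- Conditional entropy H(X|Y). -/
noncomputable def condEnt {Ω α β : Type*} [Fintype Ω] [Fintype α] [Fintype β]
    (p : Ω → ℝ) (X : Ω → α) (Y : Ω → β) : ℝ :=
  ent p (fun ω => (X ω, Y ω)) - ent p Y

/-- Mutual information I(X;Y). -/
noncomputable def mi {Ω α β : Type*} [Fintype Ω] [Fintype α] [Fintype β]
    (p : Ω → ℝ) (X : Ω → α) (Y : Ω → β) : ℝ :=
  ent p X + ent p Y - ent p (fun ω => (X ω, Y ω))

/-- Conditional mutual information I(X;Y|Z). -/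
noncomputable def cmi {Ω α β γ : Type*} [Fintype Ω] [Fintype α] [Fintype β] [Fintype γ]
    (p : Ω → ℝ) (X : Ω → α) (Y : Ω → β) (Z : Ω → γ) : ℝ :=
  ent p (fun ω => (X ω, Z ω)) + ent p (fun ω => (Y ω, Z ω))
    - ent p (fun ω => ((X ω, Y ω), Z ω)) - ent p Z

/-- `p` is a probability mass function. -/
def IsPMF {Ω : Type*} [Fintype Ω] (p : Ω → ℝ) : Prop :=
  (∀ ω, 0 ≤ p ω) ∧ ∑ ω, p ω = 1

/-- Bipartite graph on 𝒳 ⊔ 𝒴 with an edge between x and y iff the joint pmf μ(x,y) > 0. -/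
def edge {α β : Type*} (μ : α × β → ℝ) : α ⊕ β → α ⊕ β → Prop
  | Sum.inl x, Sum.inr y => 0 < μ (x, y)
  | Sum.inr y, Sum.inl x => 0 < μ (x, y)
  | _, _ => False

section Prob

variable {Ω α β γ : Type*} [Fintype Ω] {p : Ω → ℝ}

lemma prob_nonneg (hp : ∀ ω, 0 ≤ p ω) (V : Ω → α) (v : α) : 0 ≤ prob p V v :=
  Finset.sum_nonneg fun ω _ => by split_ifs <;> simp [hp]

/-- Monotonicity of probability under almost sure implication of events. -/
lemma prob_le_prob (hp : ∀ ω, 0 ≤ p ω) {V : Ω → α} {W : Ω → β} {v : α} {w : β}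
    (h : ∀ ω, p ω ≠ 0 → V ω = v → W ω = w) : prob p V v ≤ prob p W w := by
  refine Finset.sum_le_sum fun ω _ => ?_
  by_cases h0 : p ω = 0
  · simp [h0]
  by_cases hv : V ω = v
  · simp [hv, h ω h0 hv]
  · rw [if_neg hv]
    split_ifs <;> simp [hp]

lemma prob_congr (hp : ∀ ω, 0 ≤ p ω) {V : Ω → α} {W : Ω → β} {v : α} {w : β}
    (h : ∀ ω, p ω ≠ 0 → (V ω = v ↔ W ω = w)) : prob p V v = prob p W w :=
  le_antisymm (prob_le_prob hp fun ω h0 => (h ω h0).1) (prob_le_prob hp fun ω h0 => (h ω h0).2)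

lemma prob_apply_pos (hp : ∀ ω, 0 ≤ p ω) (V : Ω → α) {ω : Ω} (h : p ω ≠ 0) :
    0 < prob p V (V ω) := by
  refine Finset.sum_pos' (fun ω' _ => by split_ifs <;> simp [hp]) ⟨ω, Finset.mem_univ _, ?_⟩
  simpa using lt_of_le_of_ne (hp ω) h.symm

/-- The expectation of a function of a random variable, computed from its distribution. -/
lemma sum_prob_mul [Fintype α] (p : Ω → ℝ) (V : Ω → α) (F : α → ℝ) :
    ∑ v, prob p V v * F v = ∑ ω, p ω * F (V ω) := by
  classical
  simp only [prob, Finset.sum_mul]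
  rw [Finset.sum_comm]
  refine Finset.sum_congr rfl fun ω _ => ?_
  rw [Finset.sum_eq_single (V ω)] <;> simp +contextual [eq_comm]

open Classical in
lemma prob_comp [Fintype β] (p : Ω → ℝ) (B : Ω → β) (φ : β → γ) (c : γ) :
    prob p (fun ω => φ (B ω)) c = ∑ b, if φ b = c then prob p B b else 0 := by
  have := sum_prob_mul p B fun b => if φ b = c then 1 else 0
  simp only [mul_ite, mul_one, mul_zero] at this
  exact this.symm

open Classical in
lemma prob_prodMk_comp [Fintype β] (p : Ω → ℝ) (A : Ω → α) (B : Ω → β) (φ : β → γ)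
    (a : α) (c : γ) :
    prob p (fun ω => (A ω, φ (B ω))) (a, c)
      = ∑ b, if φ b = c then prob p (fun ω => (A ω, B ω)) (a, b) else 0 := by
  have hmass (V : Ω → β) (b : β) : prob p (fun ω => (A ω, V ω)) (a, b)
      = prob (fun ω => if A ω = a then p ω else 0) V b :=
    Finset.sum_congr rfl fun ω _ => by simp only [Prod.mk.injEq, ite_and]; split_ifs <;> rfl
  have hmass_comp : prob p (fun ω => (A ω, φ (B ω))) (a, c)
      = prob (fun ω => if A ω = a then p ω else 0) (fun ω => φ (B ω)) c :=
    Finset.sum_congr rfl fun ω _ => by simp only [Prod.mk.injEq, ite_and]; split_ifs <;> rfl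
  simp only [hmass_comp, hmass, prob_comp]

lemma sum_prob_prodMk [Fintype α] (p : Ω → ℝ) (A : Ω → α) (B : Ω → β) (b : β) :
    ∑ a, prob p (fun ω => (A ω, B ω)) (a, b) = prob p B b := by
  classical
  simp only [prob]
  rw [Finset.sum_comm]
  refine Finset.sum_congr rfl fun ω _ => ?_
  rw [Finset.sum_eq_single (A ω)] <;> simp +contextual [eq_comm]

/-- Entropy as the expected surprisal. -/
lemma ent_eq_sum [Fintype α] (p : Ω → ℝ) (V : Ω → α) :
    ent p V = ∑ ω, p ω * -Real.log (prob p V (V ω)) := by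
  rw [← sum_prob_mul p V fun v => -Real.log (prob p V v)]
  simp [ent, Real.negMulLog]

lemma ent_congr [Fintype α] [Fintype β] (hp : ∀ ω, 0 ≤ p ω) {V : Ω → α} {W : Ω → β}
    (h : ∀ ω ω', p ω ≠ 0 → p ω' ≠ 0 → (V ω' = V ω ↔ W ω' = W ω)) : ent p V = ent p W := by
  rw [ent_eq_sum, ent_eq_sum]
  refine Finset.sum_congr rfl fun ω _ => ?_
  by_cases h0 : p ω = 0
  · simp [h0]
  · rw [prob_congr hp fun ω' h' => h ω ω' h0 h']

lemma condEnt_nonneg [Fintype α] [Fintype β] (hp : ∀ ω, 0 ≤ p ω) (V : Ω → α) (W : Ω → β) :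
    0 ≤ condEnt p V W := by
  rw [condEnt, ent_eq_sum, ent_eq_sum, ← Finset.sum_sub_distrib]
  refine Finset.sum_nonneg fun ω _ => ?_
  by_cases h0 : p ω = 0
  · simp [h0]
  rw [← mul_sub]
  refine mul_nonneg (hp ω) ?_
  have := Real.log_le_log (prob_apply_pos hp (fun ω => (V ω, W ω)) h0)
    (prob_le_prob hp (W := W) (w := W ω) fun ω' _ h => (Prod.ext_iff.1 h).2)
  linarith

/-- Vanishing conditional mutual information forces conditional independence. -/
lemma prob_mul_prob_of_cmi_eq_zero [Fintype α] [Fintype β] [Fintype γ] (hp : ∀ ω, 0 ≤ p ω)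
    {A : Ω → α} {B : Ω → β} {Z : Ω → γ} (h : cmi p A B Z = 0) (a : α) (b : β) (z : γ) :
    prob p (fun ω => ((A ω, B ω), Z ω)) ((a, b), z) * prob p Z z
      = prob p (fun ω => (A ω, Z ω)) (a, z) * prob p (fun ω => (B ω, Z ω)) (b, z) := by
  set u : (α × β) × γ → ℝ := prob p (fun ω => ((A ω, B ω), Z ω)) with hu
  set PA : α × γ → ℝ := prob p (fun ω => (A ω, Z ω)) with hPA
  set PB : β × γ → ℝ := prob p (fun ω => (B ω, Z ω)) with hPB
  set PZ : γ → ℝ := prob p Z with hPZ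
  have hu0 : ∀ v, 0 ≤ u v := prob_nonneg hp _
  have hA0 : ∀ v, 0 ≤ PA v := prob_nonneg hp _
  have hB0 : ∀ v, 0 ≤ PB v := prob_nonneg hp _
  have hZ0 : ∀ v, 0 ≤ PZ v := prob_nonneg hp _
  have huA : ∀ v, u v ≤ PA (v.1.1, v.2) := fun v =>
    prob_le_prob hp fun ω _ h => by simp [← h]
  have huB : ∀ v, u v ≤ PB (v.1.2, v.2) := fun v =>
    prob_le_prob hp fun ω _ h => by simp [← h]
  have hAZ : ∀ v, PA v ≤ PZ v.2 := fun v => prob_le_prob hp fun ω _ h => by simp [← h]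
  let w : (α × β) × γ → ℝ := fun v => PA (v.1.1, v.2) * PB (v.1.2, v.2) / PZ v.2
  have hw0 : ∀ v, 0 ≤ w v := fun v => div_nonneg (mul_nonneg (hA0 _) (hB0 _)) (hZ0 _)
  have hwu : ∀ v, w v = 0 → u v = 0 := by
    intro v hv
    by_contra hne
    have h1 : 0 < u v := lt_of_le_of_ne (hu0 v) (Ne.symm hne)
    have h2 := h1.trans_le (huA v)
    have h3 := h1.trans_le (huB v)
    have h4 := h2.trans_le (hAZ _)
    exact (div_pos (mul_pos h2 h3) h4).ne' hv
  have hsumu : ∑ v, u v = ∑ ω, p ω := by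
    simpa using sum_prob_mul p (fun ω => ((A ω, B ω), Z ω)) fun _ => 1
  have hsumw : ∑ v, w v = ∑ ω, p ω := by
    have hz : ∑ z, PZ z = ∑ ω, p ω := by simpa using sum_prob_mul p Z fun _ => 1
    rw [Fintype.sum_prod_type_right, ← hz]
    refine Finset.sum_congr rfl fun z _ => ?_
    rw [Fintype.sum_prod_type]
    simp only [w, ← Finset.sum_div, ← Finset.mul_sum, ← Finset.sum_mul]
    rw [hPA, hPB, sum_prob_prodMk, sum_prob_prodMk, ← hPZ, mul_self_div_self]
  have hlog : ∑ v, u v * Real.log (u v / w v) = 0 := by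
    rw [← h, hu, sum_prob_mul p (fun ω => ((A ω, B ω), Z ω)) fun v => Real.log (u v / w v), cmi]
    simp only [ent_eq_sum, ← Finset.sum_sub_distrib, ← Finset.sum_add_distrib]
    refine Finset.sum_congr rfl fun ω _ => ?_
    by_cases h0 : p ω = 0
    · simp [h0]
    have h1 := prob_apply_pos hp (fun ω => ((A ω, B ω), Z ω)) h0
    have h2 := prob_apply_pos hp (fun ω => (A ω, Z ω)) h0
    have h3 := prob_apply_pos hp (fun ω => (B ω, Z ω)) h0
    have h4 := prob_apply_pos hp Z h0
    simp only [w, hu, hPA, hPB, hPZ]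
    rw [Real.log_div h1.ne' (div_pos (mul_pos h2 h3) h4).ne',
      Real.log_div (mul_pos h2 h3).ne' h4.ne', Real.log_mul h2.ne' h3.ne']
    ring
  have hkl : ∑ v, w v * InformationTheory.klFun (u v / w v) = 0 := by
    calc ∑ v, w v * InformationTheory.klFun (u v / w v)
        = ∑ v, (u v * Real.log (u v / w v) + w v - u v) := by
          refine Finset.sum_congr rfl fun v _ => ?_
          by_cases h0 : w v = 0
          · simp [h0, hwu v h0]
          · rw [InformationTheory.klFun]
            field_simp
      _ = 0 := by
          rw [Finset.sum_sub_distrib, Finset.sum_add_distrib, hlog, hsumu, hsumw]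
          ring
  have hterm := (Finset.sum_eq_zero_iff_of_nonneg fun v _ => mul_nonneg (hw0 v)
    (InformationTheory.klFun_nonneg (div_nonneg (hu0 v) (hw0 v)))).1 hkl
      ((a, b), z) (Finset.mem_univ _)
  have huw : u ((a, b), z) = w ((a, b), z) := by
    rcases mul_eq_zero.1 hterm with h0 | h0
    · rw [h0, hwu _ h0]
    · rw [InformationTheory.klFun_eq_zero_iff (div_nonneg (hu0 _) (hw0 _))] at h0
      exact eq_of_div_eq_one h0
  rw [huw]
  by_cases h0 : PZ z = 0
  · have : PA (a, z) = 0 := le_antisymm ((hAZ (a, z)).trans h0.le) (hA0 _)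
    simp [h0, this]
  · exact div_mul_cancel₀ _ h0

end Prob

theorem stmt3 {Ω 𝒳 𝒴 𝒬 γ : Type*} [Fintype Ω] [Fintype 𝒳] [Fintype 𝒴] [Fintype 𝒬]
    [Fintype γ]
    (p : Ω → ℝ) (hp : IsPMF p) (X : Ω → 𝒳) (Y : Ω → 𝒴) (Q : Ω → 𝒬)
    (f : 𝒳 ⊕ 𝒴 → γ)
    (hf : ∀ a b, f a = f b ↔
      Relation.EqvGen (edge (fun ab => prob p (fun ω => (X ω, Y ω)) ab)) a b)
    (h1 : cmi p Q Y X = 0) (h2 : cmi p Q X Y = 0) :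
    cmi p X Y Q
      = condEnt p (fun ω => f (Sum.inl (X ω))) Q
        + cmi p X Y (fun ω => f (Sum.inl (X ω))) ∧
    cmi p X Y (fun ω => f (Sum.inl (X ω))) ≤ cmi p X Y Q := by
  obtain ⟨hp, -⟩ := hp
  have hcond : ∀ q a b, f a = f b →
      Sum.elim (fun x => prob p (fun ω => (Q ω, X ω)) (q, x) / prob p X x)
          (fun y => prob p (fun ω => (Q ω, Y ω)) (q, y) / prob p Y y) a
        = Sum.elim (fun x => prob p (fun ω => (Q ω, X ω)) (q, x) / prob p X x)
          (fun y => prob p (fun ω => (Q ω, Y ω)) (q, y) / prob p Y y) b := by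
    intro q a b hab
    have key : ∀ x y, 0 < prob p (fun ω => (X ω, Y ω)) (x, y) →
        prob p (fun ω => (Q ω, X ω)) (q, x) / prob p X x
          = prob p (fun ω => (Q ω, Y ω)) (q, y) / prob p Y y := by
      intro x y hxy
      have hx : 0 < prob p X x :=
        hxy.trans_le (prob_le_prob hp fun ω _ h => (Prod.ext_iff.1 h).1)
      have hy : 0 < prob p Y y :=
        hxy.trans_le (prob_le_prob hp fun ω _ h => (Prod.ext_iff.1 h).2)
      have e1 := prob_mul_prob_of_cmi_eq_zero hp h1 q y x
      have e2 := prob_mul_prob_of_cmi_eq_zero hp h2 q x y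
      have e3 : prob p (fun ω => ((Q ω, Y ω), X ω)) ((q, y), x)
          = prob p (fun ω => ((Q ω, X ω), Y ω)) ((q, x), y) :=
        prob_congr hp fun ω _ => by simp only [Prod.mk.injEq]; tauto
      have e4 : prob p (fun ω => (Y ω, X ω)) (y, x) = prob p (fun ω => (X ω, Y ω)) (x, y) :=
        prob_congr hp fun ω _ => by simp only [Prod.mk.injEq]; tauto
      rw [e3, e4] at e1
      rw [div_eq_div_iff hx.ne' hy.ne']
      refine mul_right_cancel₀ hxy.ne' ?_
      linear_combination (-prob p Y y) * e1 + prob p X x * e2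
    induction (hf a b).1 hab with
    | rel a b h =>
      rcases a with x | y <;> rcases b with x' | y'
      · exact h.elim
      · exact key x y' h
      · exact (key x' y h).symm
      · exact h.elim
    | refl a => rfl
    | symm a b h ih => exact (ih ((hf _ _).2 h)).symm
    | trans a b c h h' ih ih' => exact (ih ((hf _ _).2 h)).trans (ih' ((hf _ _).2 h'))
  set C : Ω → γ := fun ω => f (Sum.inl (X ω)) with hC
  have hCY : ∀ ω, p ω ≠ 0 → C ω = f (Sum.inr (Y ω)) := fun ω h0 =>
    (hf _ _).2 (.rel _ _ (prob_apply_pos hp (fun ω => (X ω, Y ω)) h0))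
  have hXC : ent p (fun ω => (X ω, C ω)) = ent p X :=
    ent_congr hp fun ω ω' _ _ => by simp +contextual [hC]
  have hYC : ent p (fun ω => (Y ω, C ω)) = ent p Y :=
    ent_congr hp fun ω ω' h h' => by simp +contextual [hCY ω h, hCY ω' h']
  have hXYC : ent p (fun ω => ((X ω, Y ω), C ω)) = ent p (fun ω => (X ω, Y ω)) :=
    ent_congr hp fun ω ω' _ _ => by simp +contextual [hC]
  have hQX : ent p (fun ω => (Q ω, X ω)) = ent p (fun ω => (X ω, Q ω)) :=
    ent_congr hp fun ω ω' _ _ => by simp only [Prod.mk.injEq]; tauto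
  have hQY : ent p (fun ω => (Q ω, Y ω)) = ent p (fun ω => (Y ω, Q ω)) :=
    ent_congr hp fun ω ω' _ _ => by simp only [Prod.mk.injEq]; tauto
  have hQC : ent p (fun ω => (Q ω, C ω)) = ent p (fun ω => (C ω, Q ω)) :=
    ent_congr hp fun ω ω' _ _ => by simp only [Prod.mk.injEq]; tauto
  have hYX : ent p (fun ω => (Y ω, X ω)) = ent p (fun ω => (X ω, Y ω)) :=
    ent_congr hp fun ω ω' _ _ => by simp only [Prod.mk.injEq]; tauto
  have hQYX : ent p (fun ω => ((Q ω, Y ω), X ω)) = ent p (fun ω => ((X ω, Y ω), Q ω)) :=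
    ent_congr hp fun ω ω' _ _ => by simp only [Prod.mk.injEq]; tauto
  have hQXY : ent p (fun ω => ((Q ω, X ω), Y ω)) = ent p (fun ω => ((X ω, Y ω), Q ω)) :=
    ent_congr hp fun ω ω' _ _ => by simp only [Prod.mk.injEq]; tauto
  have hprop : ∀ q x, 0 < prob p X x →
      prob p (fun ω => (Q ω, C ω)) (q, f (Sum.inl x)) * prob p X x
        = prob p (fun ω => (Q ω, X ω)) (q, x) * prob p C (f (Sum.inl x)) := by
    classical
    intro q x hx
    rw [prob_prodMk_comp p Q X fun x => f (Sum.inl x),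
      prob_comp p X (fun x => f (Sum.inl x)), Finset.sum_mul, Finset.mul_sum]
    refine Finset.sum_congr rfl fun x' _ => ?_
    split_ifs with hxx
    · rcases (prob_nonneg hp X x').eq_or_lt with h0 | h0
      · have : prob p (fun ω => (Q ω, X ω)) (q, x') = 0 :=
          le_antisymm ((prob_le_prob hp fun ω _ h => (Prod.ext_iff.1 h).2).trans h0.ge)
            (prob_nonneg hp _ _)
        simp [← h0, this]
      · have := hcond q _ _ hxx
        simp only [Sum.elim_inl] at this
        rwa [div_eq_div_iff h0.ne' hx.ne'] at this
    · simp
  have hcondEnt : condEnt p Q X = condEnt p Q C := by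
    simp only [condEnt, ent_eq_sum, ← Finset.sum_sub_distrib]
    refine Finset.sum_congr rfl fun ω _ => ?_
    by_cases h0 : p ω = 0
    · simp [h0]
    have p1 := prob_apply_pos hp (fun ω => (Q ω, C ω)) h0
    have p2 := prob_apply_pos hp X h0
    have p3 := prob_apply_pos hp (fun ω => (Q ω, X ω)) h0
    have p4 := prob_apply_pos hp C h0
    have e := congrArg Real.log (hprop (Q ω) (X ω) p2)
    rw [Real.log_mul p1.ne' p2.ne', Real.log_mul p3.ne' p4.ne'] at e
    linear_combination p ω * e
  have hmain : cmi p X Y Q = condEnt p C Q + cmi p X Y C := by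
    simp only [cmi, condEnt] at h1 h2 hcondEnt ⊢
    linarith
  exact ⟨hmain, by linarith [condEnt_nonneg hp C Q]⟩
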